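/- Let A = {−1,1}. For every integer a ≥ 1, 8·3^a − 7 ≤ s_A(C_{3^a}^4) ≤ 10·3^a − 9; that is, every sequence over C_{3^a}^4 of length at least 10·3^a − 9 has an A-zero-sum subsequence of length 3^a, and there exists a sequence over C_{3^a}^4 of length 8·3^a − 8 with no A-zero-sum subsequence of length 3^a. -/

import Mathlib

/-- A multiset `S` over an additive abelian group `G` has an `A`-zero-sum subsequence
of length `k`, for the weight set `A = {-1, 1}`: there is a sub-multiset of `S` of
cardinality `k` that splits as `t₁ + t₂` with `t₁.sum - t₂.sum = 0` (the elements of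
`t₁` receive the weight `+1` and those of `t₂` the weight `-1`). -/
def HasWZSS {G : Type*} [AddCommGroup G] (S : Multiset G) (k : ℕ) : Prop :=
  ∃ t₁ t₂ : Multiset G, t₁ + t₂ ≤ S ∧ Multiset.card (t₁ + t₂) = k ∧ t₁.sum = t₂.sum

/-- `sA G` is the smallest `ℓ` such that every sequence over `G` of length at least `ℓ`
has an `{-1,1}`-zero-sum subsequence of length `exp G`. -/
noncomputable def sA (G : Type*) [AddCommGroup G] : ℕ :=
  sInf {ℓ : ℕ | ∀ S : Multiset G, ℓ ≤ Multiset.card S →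
    HasWZSS S (AddMonoid.exponent G)}

/-- `etaA G` is the smallest `ℓ` such that every sequence over `G` of length at least `ℓ`
has a nonempty `{-1,1}`-zero-sum subsequence of length at most `exp G`. -/
noncomputable def etaA (G : Type*) [AddCommGroup G] : ℕ :=
  sInf {ℓ : ℕ | ∀ S : Multiset G, ℓ ≤ Multiset.card S →
    ∃ k, 1 ≤ k ∧ k ≤ AddMonoid.exponent G ∧ HasWZSS S k}

/-- `gA G` is the smallest `ℓ` such that every sequence over `G` of length at least `ℓ`
consisting of pairwise distinct elements has an `{-1,1}`-zero-sum subsequence of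
length `exp G`. -/
noncomputable def gA (G : Type*) [AddCommGroup G] : ℕ :=
  sInf {ℓ : ℕ | ∀ S : Multiset G, ℓ ≤ Multiset.card S → S.Nodup →
    HasWZSS S (AddMonoid.exponent G)}

abbrev V3 := Fin 4 → ZMod 3

lemma zmod3_cases (c : ZMod 3) : c = 0 ∨ c = 1 ∨ c = -1 := by
  revert c; decide

lemma v3_three (v : V3) : v + v + v = 0 := by
  funext j
  simp only [Pi.add_apply, Pi.zero_apply]
  generalize v j = c
  revert c; decide

lemma v3_neg_ne {v : V3} (h : v ≠ 0) : v ≠ -v := by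
  intro e
  apply h
  funext j
  have := congrFun e j
  simp only [Pi.neg_apply, Pi.zero_apply] at *
  generalize v j = c at *
  revert c; decide

/-- Sizes of symmetric cap-like sets. -/
lemma cap_bound (T : Finset V3) (h0 : (0 : V3) ∉ T) (hs : ∀ x ∈ T, -x ∈ T)
    (hT : ∀ x ∈ T, ∀ y ∈ T, x ≠ y → x + y ∉ T) : T.card ≤ 20 := by
  classical
  by_contra hcard
  push Not at hcard
  obtain ⟨x, hx⟩ : T.Nonempty := Finset.card_pos.1 (by omega)
  obtain ⟨y, hy, hyx⟩ : ∃ y ∈ T, y ∉ ({x, -x} : Finset V3) := by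
    by_contra hcon
    push Not at hcon
    have := Finset.card_le_card (show T ⊆ ({x, -x} : Finset V3) from hcon)
    have := Finset.card_le_two (a := x) (b := -x)
    omega
  simp only [Finset.mem_insert, Finset.mem_singleton, not_or] at hyx
  obtain ⟨hyx1, hyx2⟩ := hyx
  have hx0 : x ≠ 0 := fun h => h0 (h ▸ hx)
  have hy0 : y ≠ 0 := fun h => h0 (h ▸ hy)
  set W : Submodule (ZMod 3) V3 := Submodule.span (ZMod 3) {x, y} with hW
  have memW : ∀ z, z ∈ W ↔ ∃ a b : ZMod 3, a • x + b • y = z := fun z =>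
    Submodule.mem_span_pair
  have cases9 : ∀ z ∈ W, z = 0 ∨ z = x ∨ z = -x ∨ z = y ∨ z = -y ∨
      z = x + y ∨ z = -(x + y) ∨ z = x - y ∨ z = -(x - y) := by
    intro z hz
    obtain ⟨a, b, rfl⟩ := (memW z).1 hz
    rcases zmod3_cases a with rfl | rfl | rfl <;> rcases zmod3_cases b with rfl | rfl | rfl <;>
      simp <;> grind
  have hxy : x + y ∉ T := hT x hx y hy (Ne.symm hyx1)
  have hxy' : x - y ∉ T := by
    rw [sub_eq_add_neg]
    exact hT x hx (-y) (hs y hy) (by rintro h; apply hyx2; rw [h]; simp)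
  have nT : ∀ z, z ∉ T → -z ∉ T := fun z hz h => hz (by simpa using hs _ h)
  have WT : ∀ z ∈ W, z ∈ T → z ∈ ({x, -x, y, -y} : Finset V3) := by
    intro z hz hzT
    simp only [Finset.mem_insert, Finset.mem_singleton]
    rcases cases9 z hz with h | h | h | h | h | h | h | h | h
    · exact absurd (h ▸ hzT) h0
    · tauto
    · tauto
    · tauto
    · tauto
    · exact absurd (h ▸ hzT) hxy
    · exact absurd (h ▸ hzT) (nT _ hxy)
    · exact absurd (h ▸ hzT) hxy'
    · exact absurd (h ▸ hzT) (nT _ hxy')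
  have W4 : ∀ z ∈ W, z ∉ T → z ≠ 0 → 
      z = x + y ∨ z = -(x + y) ∨ z = x - y ∨ z = -(x - y) := by
    intro z hz hzT hz0
    rcases cases9 z hz with h | h | h | h | h | h
    · exact absurd h hz0
    · exact absurd (h ▸ hx) hzT
    · exact absurd (h ▸ hs x hx) hzT
    · exact absurd (h ▸ hy) hzT
    · exact absurd (h ▸ hs y hy) hzT
    · exact h
  -- cardinality of W
  have key : ∀ a b : ZMod 3, a • x + b • y = 0 → a = 0 ∧ b = 0 := by
    intro a b hab
    rcases zmod3_cases a with rfl | rfl | rfl <;> rcases zmod3_cases b with rfl | rfl | rfl <;>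
      simp at hab ⊢
    · exact hy0 hab
    · exact hy0 hab
    · exact hx0 hab
    · exact hyx2 (by rw [eq_neg_iff_add_eq_zero, add_comm]; exact hab)
    · exact hyx1 (by rw [← sub_eq_add_neg, sub_eq_zero] at hab; exact hab.symm)
    · exact hx0 hab
    · exact hyx1 (by rw [neg_add_eq_zero] at hab; exact hab.symm)
    · apply hyx2
      have : -(x + y) = 0 := by rw [← hab]; abel
      rw [neg_eq_zero] at this
      rw [eq_neg_iff_add_eq_zero, add_comm]; exact this
  have cardW : 9 ≤ Nat.card W := by
    let φ : ZMod 3 × ZMod 3 → W := fun p => ⟨p.1 • x + p.2 • y, (memW _).2 ⟨_, _, rfl⟩⟩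
    have hφ : Function.Injective φ := by
      rintro ⟨a, b⟩ ⟨c, d⟩ h
      have h' : a • x + b • y = c • x + d • y := congrArg Subtype.val h
      have := key (a - c) (b - d) (by
        rw [sub_smul, sub_smul]
        have : a • x - c • x + (b • y - d • y) = (a • x + b • y) - (c • x + d • y) := by abel
        rw [this, h', sub_self])
      rw [sub_eq_zero, sub_eq_zero] at this
      exact Prod.ext this.1 this.2
    have := Nat.card_le_card_of_injective φ hφ
    simpa [Nat.card_prod, Nat.card_zmod] using this
  have cardQ : Nat.card (V3 ⧸ W) ≤ 9 := by
    have h := Submodule.card_eq_card_quotient_mul_card W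
    have h81 : Nat.card V3 = 81 := by simp [Nat.card_eq_fintype_card]
    rw [h81] at h
    by_contra hc
    push Not at hc
    nlinarith
  haveI : Fintype (V3 ⧸ W) := Fintype.ofFinite _
  rw [Nat.card_eq_fintype_card] at cardQ
  set T' := T.filter (fun z => z ∉ W) with hT'
  have cardT' : 17 ≤ T'.card := by
    have h1 : T'.card + (T.filter (fun z => ¬ z ∉ W)).card = T.card := by
      rw [hT']
      convert Finset.card_filter_add_card_filter_not (s := T) (fun z => z ∉ W)
    have h2 : (T.filter (fun z => ¬ z ∉ W)).card ≤ 4 := by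
      refine (Finset.card_le_card (t := ({x, -x, y, -y} : Finset V3)) ?_).trans Finset.card_le_four
      intro z hz
      rw [Finset.mem_filter, not_not] at hz
      exact WT z hz.2 hz.1
    omega
  have maps : ∀ z ∈ T', W.mkQ z ∈ (Finset.univ.erase 0 : Finset (V3 ⧸ W)) := by
    intro z hz
    rw [Finset.mem_erase]
    refine ⟨?_, Finset.mem_univ _⟩
    intro h
    exact (Finset.mem_filter.1 hz).2 ((Submodule.Quotient.mk_eq_zero W).1 h)
  obtain ⟨q, -, hq⟩ := Finset.exists_lt_card_fiber_of_mul_lt_card_of_maps_to (n := 2) maps (by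
    rw [Finset.card_erase_of_mem (Finset.mem_univ _), Finset.card_univ]; omega)
  obtain ⟨a, b, c, ha, hb, hc, hab, hac, hbc⟩ := Finset.two_lt_card_iff.1 hq
  simp only [hT', Finset.mem_filter] at ha hb hc
  have diff : ∀ a b, (a ∈ T ∧ a ∉ W) → b ∈ T → W.mkQ a = q → W.mkQ b = q → a ≠ b →
      b - a = x + y ∨ b - a = -(x + y) ∨ b - a = x - y ∨ b - a = -(x - y) := by
    intro a b ha hb hqa hqb hne
    have hm : b - a ∈ W := by
      rw [← Submodule.Quotient.mk_eq_zero W, ← Submodule.mkQ_apply, map_sub, hqa, hqb, sub_self]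
    apply W4 _ hm _ (sub_ne_zero.2 (Ne.symm hne))
    intro hmT
    have hne2 : a ≠ b - a := by
      intro h
      exact ha.2 (h ▸ hm)
    have := hT a ha.1 _ hmT hne2
    simp at this
    exact this hb
  have d1 := diff a b ha.1 hb.1.1 ha.2 hb.2 hab
  have d2 := diff a c ha.1 hc.1.1 ha.2 hc.2 hac
  have d3 := diff b c hb.1 hc.1.1 hb.2 hc.2 hbc
  have hopp : c - a = -(b - a) := by
    have e3 : c - b = (c - a) - (b - a) := by abel
    have hx2 := v3_three x
    have hy2 := v3_three y
    have hbc' : b - a ≠ c - a := fun h => hbc (sub_left_injective h)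
    have hcb : c - b ∉ ({x, -x, y, -y} : Finset V3) := by
      have hcT : c - b ∉ T := by
        rcases d3 with h | h | h | h <;> rw [h]
        · exact hxy
        · exact nT _ hxy
        · exact hxy'
        · exact nT _ hxy'
      intro hmem
      simp only [Finset.mem_insert, Finset.mem_singleton] at hmem
      rcases hmem with h | h | h | h <;> apply hcT <;> rw [h]
      · exact hx
      · exact hs _ hx
      · exact hy
      · exact hs _ hy
    simp only [Finset.mem_insert, Finset.mem_singleton, not_or] at hcb
    rw [e3] at hcb
    have ex : x + x = -x := by rw [eq_neg_iff_add_eq_zero]; exact hx2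
    have ey : y + y = -y := by rw [eq_neg_iff_add_eq_zero]; exact hy2
    generalize b - a = u at *
    generalize c - a = v at *
    obtain ⟨n1, n2, n3, n4⟩ := hcb
    rcases d1 with rfl | rfl | rfl | rfl <;> rcases d2 with rfl | rfl | rfl | rfl <;>
      first
      | exact absurd rfl hbc'
      | (simp; done)
      | (exfalso; apply n1; grind)
      | (exfalso; apply n2; grind)
      | (exfalso; apply n3; grind)
      | (exfalso; apply n4; grind)
  have hsum : c = -(a + b) := by
    have h3 := v3_three a
    have : c = a - (b - a) := by rw [sub_eq_add_neg, ← hopp]; abel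
    rw [this, eq_neg_iff_add_eq_zero]
    rw [← h3]; abel
  exact nT _ (hT a ha.1.1 b hb.1.1 hab) (hsum ▸ hc.1.1)

/-- Indexed form of a weighted zero-sum subsequence modulo `n`. -/
def GoodSet {ι : Type} (f : ι → Fin 4 → ℤ) (n : ℕ) (t : Finset ι) : Prop :=
  t.card = n ∧ ∃ e : ι → ℤ, (∀ i ∈ t, e i = 1 ∨ e i = -1) ∧
    ∀ j, (n : ℤ) ∣ ∑ i ∈ t, e i * f i j

def redV {ι : Type} (f : ι → Fin 4 → ℤ) (i : ι) : V3 := fun j => ((f i j : ℤ) : ZMod 3)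

lemma good_triple {ι : Type} [DecidableEq ι] (f : ι → Fin 4 → ℤ) {i j k : ι} (hij : i ≠ j)
    (hik : i ≠ k) (hjk : j ≠ k) {a b c : ℤ} (ha : a = 1 ∨ a = -1) (hb : b = 1 ∨ b = -1)
    (hc : c = 1 ∨ c = -1) (h : a • redV f i + b • redV f j + c • redV f k = 0) :
    GoodSet f 3 {i, j, k} := by
  refine ⟨Finset.card_eq_three.2 ⟨i, j, k, hij, hik, hjk, rfl⟩,
    fun l => if l = i then a else if l = j then b else c, ?_, ?_⟩
  · intro l _
    dsimp only
    split_ifs <;> assumption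
  · intro l
    rw [Finset.sum_insert (by simp [hij, hik]), Finset.sum_pair hjk]
    have := congrFun h l
    simp [redV] at this
    rw [← ZMod.intCast_zmod_eq_zero_iff_dvd] 
    simp [hij.symm, hik.symm, hjk.symm]
    rw [← this]; ring

lemma base_case {ι : Type} [DecidableEq ι] (f : ι → Fin 4 → ℤ) (s : Finset ι)
    (hs : 21 ≤ s.card) : ∃ t ⊆ s, GoodSet f 3 t := by
  classical
  by_contra hcon
  push Not at hcon
  set g := redV f with hg
  have notri : ∀ i ∈ s, ∀ j ∈ s, ∀ k ∈ s, i ≠ j → i ≠ k → j ≠ k → ∀ a b c : ℤ,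
      (a = 1 ∨ a = -1) → (b = 1 ∨ b = -1) → (c = 1 ∨ c = -1) →
      a • g i + b • g j + c • g k ≠ 0 := by
    intro i hi j hj k hk hij hik hjk a b c ha hb hc h
    refine hcon {i, j, k} ?_ (good_triple f hij hik hjk ha hb hc h)
    intro l hl
    simp only [Finset.mem_insert, Finset.mem_singleton] at hl
    rcases hl with rfl | rfl | rfl <;> assumption
  set T : Finset V3 := Finset.univ.filter (fun v => v ≠ 0 ∧
    ∃ i ∈ s, ∃ a : ℤ, (a = 1 ∨ a = -1) ∧ a • g i = v) with hT
  have memT : ∀ v, v ∈ T ↔ v ≠ 0 ∧ ∃ i ∈ s, ∃ a : ℤ, (a = 1 ∨ a = -1) ∧ a • g i = v := by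
    intro v; simp [hT]
  have Tsym : ∀ v ∈ T, -v ∈ T := by
    intro v hv
    rw [memT] at hv ⊢
    obtain ⟨h0, i, hi, a, ha, e⟩ := hv
    refine ⟨neg_ne_zero.2 h0, i, hi, -a, by omega, by rw [neg_smul, e]⟩
  have pm : ∀ a : ℤ, (a = 1 ∨ a = -1) → ∀ v w : V3, a • v = w → v = w ∨ v = -w := by
    rintro a (rfl | rfl) v w rfl <;> simp
  have Tsum : ∀ x ∈ T, ∀ y ∈ T, x ≠ y → x + y ∉ T := by
    intro x hx y hy hxy hz
    obtain ⟨x0, i, hi, a, ha, ea⟩ := (memT _).1 hx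
    obtain ⟨y0, j, hj, b, hb, eb⟩ := (memT _).1 hy
    obtain ⟨z0, k, hk, c, hc, ec⟩ := (memT _).1 hz
    have hx3 := v3_three x
    have hy3 := v3_three y
    have hij : i ≠ j := by
      rintro rfl
      rcases pm a ha _ _ ea with h1 | h1 <;> rcases pm b hb _ _ eb with h2 | h2 <;> grind
    have hik : i ≠ k := by
      rintro rfl
      rcases pm a ha _ _ ea with h1 | h1 <;> rcases pm c hc _ _ ec with h2 | h2 <;> grind
    have hjk : j ≠ k := by
      rintro rfl
      rcases pm b hb _ _ eb with h1 | h1 <;> rcases pm c hc _ _ ec with h2 | h2 <;> grind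
    refine notri i hi j hj k hk hij hik hjk a b (-c) ha hb (by omega) ?_
    rw [neg_smul, ea, eb, ec]; abel
  have hTc := cap_bound T (by simp [hT]) Tsym Tsum
  set s' := s.filter (fun i => g i ≠ 0) with hs'
  set D := s' ×ˢ ({1, -1} : Finset ℤ) with hD
  have memD : ∀ p, p ∈ D → p.1 ∈ s ∧ g p.1 ≠ 0 ∧ (p.2 = 1 ∨ p.2 = -1) := by
    rintro ⟨i, a⟩ h
    simp [hD, hs'] at h
    exact ⟨h.1.1, h.1.2, h.2⟩
  have cardD : D.card = 2 * s'.card := by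
    rw [hD, Finset.card_product, mul_comm]; rfl
  have maps : ∀ p ∈ D, p.2 • g p.1 ∈ T := by
    intro p hp
    obtain ⟨h1, h2, h3⟩ := memD p hp
    rw [memT]
    refine ⟨?_, p.1, h1, p.2, h3, rfl⟩
    rcases h3 with h | h <;> rw [h] <;> simpa using h2
  have fibne : ∀ p ∈ D, ∀ r ∈ D, p ≠ r → p.2 • g p.1 = r.2 • g r.1 → p.1 ≠ r.1 := by
    rintro ⟨i, a⟩ hp ⟨j, b⟩ hr hne e hij
    dsimp only at *
    subst hij
    obtain ⟨h1, h2, h3⟩ := memD _ hp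
    obtain ⟨-, -, h4⟩ := memD _ hr
    dsimp only at *
    have := v3_neg_ne h2
    rcases h3 with rfl | rfl <;> rcases h4 with rfl | rfl <;> simp at e hne
    · exact this e
    · exact this e.symm
  by_cases hz : ∃ i0 ∈ s, g i0 = 0
  · obtain ⟨i0, hi0, h0⟩ := hz
    have hzero : (s.filter (fun i => ¬ g i ≠ 0)).card ≤ 2 := by
      by_contra hc
      push Not at hc
      obtain ⟨i, j, k, hi, hj, hk, hij, hik, hjk⟩ := Finset.two_lt_card_iff.1 hc
      simp only [Finset.mem_filter, not_not] at hi hj hk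
      exact notri i hi.1 j hj.1 k hk.1 hij hik hjk 1 1 1 (by simp) (by simp) (by simp)
        (by simp [hi.2, hj.2, hk.2])
    have hsplit : s'.card + (s.filter (fun i => ¬ g i ≠ 0)).card = s.card := by
      rw [hs']
      convert Finset.card_filter_add_card_filter_not (s := s) (fun i => g i ≠ 0)
    obtain ⟨v, -, hv⟩ := Finset.exists_lt_card_fiber_of_mul_lt_card_of_maps_to (n := 1) maps
      (by rw [cardD]; omega)
    obtain ⟨p, hp, r, hr, hpr⟩ := Finset.one_lt_card.1 hv
    rw [Finset.mem_filter] at hp hr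
    obtain ⟨hp1, hp2, hp3⟩ := memD _ hp.1
    obtain ⟨hr1, hr2, hr3⟩ := memD _ hr.1
    refine notri p.1 hp1 r.1 hr1 i0 hi0 (fibne p hp.1 r hr.1 hpr (hp.2.trans hr.2.symm)) ?_ ?_
      p.2 (-r.2) 1 hp3 (by omega) (by simp) ?_
    · intro h; exact hp2 (h ▸ h0)
    · intro h; exact hr2 (h ▸ h0)
    · rw [neg_smul, hp.2, hr.2, h0]; simp
  · push Not at hz
    have hss : s' = s := Finset.filter_true_of_mem hz
    obtain ⟨v, -, hv⟩ := Finset.exists_lt_card_fiber_of_mul_lt_card_of_maps_to (n := 2) maps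
      (by rw [cardD, hss]; omega)
    obtain ⟨p, r, u, hp, hr, hu, hpr, hpu, hru⟩ := Finset.two_lt_card_iff.1 hv
    rw [Finset.mem_filter] at hp hr hu
    obtain ⟨hp1, hp2, hp3⟩ := memD _ hp.1
    obtain ⟨hr1, hr2, hr3⟩ := memD _ hr.1
    obtain ⟨hu1, hu2, hu3⟩ := memD _ hu.1
    refine notri p.1 hp1 r.1 hr1 u.1 hu1 (fibne p hp.1 r hr.1 hpr (hp.2.trans hr.2.symm))
      (fibne p hp.1 u hu.1 hpu (hp.2.trans hu.2.symm))
      (fibne r hr.1 u hu.1 hru (hr.2.trans hu.2.symm)) p.2 r.2 u.2 hp3 hr3 hu3 ?_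
    rw [hp.2, hr.2, hu.2]; exact v3_three v

lemma extract {ι : Type} [DecidableEq ι] (f : ι → Fin 4 → ℤ) (s : Finset ι) (m : ℕ)
    (hs : 3 * m + 18 ≤ s.card) : ∃ F : Finset (Finset ι), F.card = m ∧
      (∀ t ∈ F, t ⊆ s ∧ GoodSet f 3 t) ∧ (F : Set (Finset ι)).PairwiseDisjoint id := by
  induction m with
  | zero => exact ⟨∅, by simp⟩
  | succ m ih =>
    obtain ⟨F, hF, hg, hd⟩ := ih (by omega)
    have hU : (F.biUnion id).card ≤ m * 3 := by
      rw [← hF]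
      exact Finset.card_biUnion_le_card_mul _ _ _ (fun t ht => (hg t ht).2.1.le)
    have hc := Finset.le_card_sdiff (F.biUnion id) s
    obtain ⟨t, hts, ht⟩ := base_case f (s \ F.biUnion id) (by omega)
    have hdis : ∀ u ∈ F, Disjoint t u := by
      intro u hu
      rw [Finset.disjoint_left]
      intro i hi hiu
      exact (Finset.mem_sdiff.1 (hts hi)).2 (Finset.mem_biUnion.2 ⟨u, hu, hiu⟩)
    have htF : t ∉ F := by
      intro h
      have := hdis t h
      rw [disjoint_self] at this
      have h3 := ht.1
      rw [this] at h3
      simp at h3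
    refine ⟨insert t F, by rw [Finset.card_insert_of_notMem htF, hF], ?_, ?_⟩
    · intro u hu
      rcases Finset.mem_insert.1 hu with rfl | hu
      · exact ⟨hts.trans Finset.sdiff_subset, ht⟩
      · exact hg u hu
    · rw [Finset.coe_insert]
      exact hd.insert (fun u hu _ => hdis u hu)

lemma upper_indexed (a : ℕ) (ha : 1 ≤ a) : ∀ {ι : Type} [DecidableEq ι] (f : ι → Fin 4 → ℤ)
    (s : Finset ι), 10 * 3 ^ a - 9 ≤ s.card → ∃ t ⊆ s, GoodSet f (3 ^ a) t := by
  induction a, ha using Nat.le_induction with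
  | base =>
    intro ι _ f s hs
    simpa using base_case f s (by simpa using hs)
  | succ a ha ih =>
    intro ι _ f s hs
    have hpos : 1 ≤ 3 ^ a := Nat.one_le_pow _ _ (by norm_num)
    rw [pow_succ] at hs
    obtain ⟨F, hF, hg, hd⟩ := extract f s (10 * 3 ^ a - 9) (by omega)
    have hex : ∀ t : Finset ι, ∃ (e : ι → ℤ) (h : Fin 4 → ℤ), t ∈ F →
        (∀ i ∈ t, e i = 1 ∨ e i = -1) ∧ ∀ j, ∑ i ∈ t, e i * f i j = 3 * h j := by
      intro t
      by_cases ht : t ∈ F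
      · obtain ⟨-, -, e, he, hdv⟩ := hg t ht
        choose h hh using hdv
        exact ⟨e, h, fun _ => ⟨he, fun j => by simpa using hh j⟩⟩
      · exact ⟨0, 0, fun h => absurd h ht⟩
    choose e h heh using hex
    obtain ⟨G, hGF, hGc, δ, hδ, hdv⟩ := ih h F hF.ge
    have hdG : (G : Set (Finset ι)).PairwiseDisjoint id := hd.subset (by exact_mod_cast hGF)
    have hw : ∀ t ∈ G, ∀ i ∈ t, ∑ u ∈ G, (if i ∈ u then δ u * e u i else 0) = δ t * e t i := by
      intro t ht i hi
      rw [Finset.sum_eq_single t]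
      · simp [hi]
      · intro u hu hut
        rw [if_neg]
        intro hiu
        exact Finset.disjoint_left.1 (hdG hu ht hut) hiu hi
      · intro h; exact absurd ht h
    refine ⟨G.biUnion id, ?_, ?_, fun i => ∑ u ∈ G, (if i ∈ u then δ u * e u i else 0), ?_, ?_⟩
    · intro i hi
      obtain ⟨t, ht, hit⟩ := Finset.mem_biUnion.1 hi
      exact (hg t (hGF ht)).1 hit
    · rw [Finset.card_biUnion hdG, Finset.sum_congr rfl
        (f := fun t : Finset ι => (id t).card) (g := fun _ => 3) (fun t ht => (hg t (hGF ht)).2.1)]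
      simp [hGc, pow_succ]
    · intro i hi
      obtain ⟨t, ht, hit⟩ := Finset.mem_biUnion.1 hi
      beta_reduce
      rw [hw t ht i hit]
      rcases hδ t ht with h1 | h1 <;> rcases (heh t (hGF ht)).1 i hit with h2 | h2 <;>
        simp [h1, h2]
    · intro j
      rw [Finset.sum_biUnion hdG]
      have : ∑ t ∈ G, ∑ i ∈ id t, (∑ u ∈ G, (if i ∈ u then δ u * e u i else 0)) * f i j
          = 3 * ∑ t ∈ G, δ t * h t j := by
        rw [Finset.mul_sum]
        refine Finset.sum_congr rfl fun t ht => ?_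
        have : ∑ i ∈ id t, (∑ u ∈ G, (if i ∈ u then δ u * e u i else 0)) * f i j
          = δ t * ∑ i ∈ t, e t i * f i j := by
          rw [Finset.mul_sum]
          refine Finset.sum_congr rfl fun i hi => ?_
          rw [hw t ht i hi]; ring
        rw [this, (heh t (hGF ht)).2 j]; ring
      rw [this]
      push_cast
      rw [pow_succ, mul_comm]
      exact mul_dvd_mul_left 3 (by exact_mod_cast hdv j)

lemma upper_multiset (a : ℕ) (ha : 1 ≤ a) (S : Multiset (Fin 4 → ZMod (3 ^ a)))
    (hS : 10 * 3 ^ a - 9 ≤ Multiset.card S) : HasWZSS S (3 ^ a) := by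
  classical
  haveI : NeZero (3 ^ a) := ⟨by positivity⟩
  obtain ⟨l, hl⟩ : ∃ l : List (Fin 4 → ZMod (3 ^ a)),
      (l : Multiset (Fin 4 → ZMod (3 ^ a))) = S := Quot.exists_rep S
  subst hl
  rw [Multiset.coe_card] at hS
  obtain ⟨t, -, hc, e, he, hdv⟩ := upper_indexed a ha
    (fun (i : Fin l.length) j => (((l.get i) j).val : ℤ)) Finset.univ (by simpa using hS)
  have hSl : (l : Multiset (Fin 4 → ZMod (3 ^ a))) =
      (Finset.univ : Finset (Fin l.length)).val.map l.get := by
    simp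
  refine ⟨(t.filter (fun i => e i = 1)).val.map l.get,
    (t.filter (fun i => ¬ e i = 1)).val.map l.get, ?_, ?_, ?_⟩
  · rw [← Multiset.map_add, Finset.filter_val, Finset.filter_val, Multiset.filter_add_not, hSl]
    exact Multiset.map_le_map (Finset.val_le_iff.2 (Finset.subset_univ _))
  · rw [← Multiset.map_add, Finset.filter_val, Finset.filter_val, Multiset.filter_add_not]
    simpa using hc
  · change ∑ i ∈ t.filter (fun i => e i = 1), l.get i = ∑ i ∈ t.filter (fun i => ¬ e i = 1), l.get i
    funext j
    rw [Finset.sum_apply, Finset.sum_apply]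
    have h := hdv j
    rw [← ZMod.intCast_zmod_eq_zero_iff_dvd, ← Finset.sum_filter_add_sum_filter_not t (fun i => e i = 1)] at h
    rw [Finset.sum_congr rfl (g := fun i => (((l.get i) j).val : ℤ)) (fun i hi => by
        rw [(Finset.mem_filter.1 hi).2, one_mul]),
      Finset.sum_congr (s₁ := t.filter (fun i => ¬ e i = 1)) rfl
        (g := fun i => -(((l.get i) j).val : ℤ)) (fun i hi => by
        have := Finset.mem_filter.1 hi
        rw [(he i this.1).resolve_left this.2]; ring)] at h
    push_cast at h
    simp only [ZMod.natCast_val, ZMod.cast_id', id_eq, Finset.sum_neg_distrib] at h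
    exact eq_of_sub_eq_zero (by rw [sub_eq_add_neg]; exact h)

/-! Lower bound -/

lemma pm_sum {n : ℕ} (u : Multiset (ZMod n)) (h : ∀ x ∈ u, x = 1 ∨ x = -1) (h1 : (1 : ZMod n) ≠ -1) :
    u.sum = (Multiset.card u : ZMod n) - 2 * (u.count (-1) : ℕ) := by
  induction u using Multiset.induction_on with
  | empty => simp
  | cons x u ih =>
    rw [Multiset.sum_cons, ih (fun y hy => h y (Multiset.mem_cons_of_mem hy)), Multiset.card_cons]
    rcases h x (Multiset.mem_cons_self x u) with rfl | rfl
    · rw [Multiset.count_cons_of_ne h1.symm]; push_cast; ring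
    · rw [Multiset.count_cons_self]; push_cast; ring

lemma pm_const {n : ℕ} (hn : Odd n) (h3 : 3 ≤ n) (u : Multiset (ZMod n))
    (h : ∀ x ∈ u, x = 1 ∨ x = -1) (hc : Multiset.card u = n) (hs : u.sum = 0) :
    ∀ x ∈ u, ∀ y ∈ u, x = y := by
  have h1 : (1 : ZMod n) ≠ -1 := by
    intro e
    have e2 : ((2 : ℕ) : ZMod n) = 0 := by
      push_cast
      have : (1 : ZMod n) + 1 = 0 := by nth_rewrite 1 [e]; ring
      rw [← this]; ring
    rw [ZMod.natCast_eq_zero_iff] at e2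
    have := Nat.le_of_dvd (by norm_num) e2
    omega
  have hsum := pm_sum u h h1
  rw [hs, hc, ZMod.natCast_self, zero_sub, eq_comm, neg_eq_zero] at hsum
  have hd : n ∣ 2 * u.count (-1) := by
    rw [← ZMod.natCast_eq_zero_iff]; push_cast; exact hsum
  have hd' : n ∣ u.count (-1) := (Nat.Coprime.dvd_mul_left (by
    rw [Nat.coprime_two_right]; exact hn)).1 hd
  have hle := Multiset.count_le_card (-1 : ZMod n) u
  rcases Nat.eq_zero_or_pos (u.count (-1)) with h0 | hp
  · have hall : ∀ x ∈ u, x = 1 := fun x hx => (h x hx).resolve_right (by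
      rintro rfl
      exact Multiset.count_eq_zero.1 h0 hx)
    intro x hx y hy
    rw [hall x hx, hall y hy]
  · have := Nat.le_of_dvd hp hd'
    have hall := Multiset.count_eq_card.1 (show u.count (-1) = Multiset.card u by omega)
    intro x hx y hy
    rw [← hall x hx, ← hall y hy]

/-- The eight sign vectors with first coordinate one. -/
def signVec (n : ℕ) (b : Fin 3 → Bool) : Fin 4 → ZMod n :=
  Fin.cons 1 (fun i => if b i then 1 else -1)

lemma lower_bound {n : ℕ} (hn : Odd n) (h3 : 3 ≤ n) :
    ∃ S : Multiset (Fin 4 → ZMod n), Multiset.card S = 8 * n - 8 ∧ ¬ HasWZSS S n := by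
  classical
  have h1 : (1 : ZMod n) ≠ -1 := by
    intro e
    have e2 : ((2 : ℕ) : ZMod n) = 0 := by
      push_cast
      have : (1 : ZMod n) + 1 = 0 := by nth_rewrite 1 [e]; ring
      rw [← this]; ring
    rw [ZMod.natCast_eq_zero_iff] at e2
    have := Nat.le_of_dvd (by norm_num) e2
    omega
  have hinj : Function.Injective (signVec n) := by
    intro b c h
    funext i
    have := congrFun h i.succ
    simp only [signVec, Fin.cons_succ] at this
    cases hb : b i <;> cases hc : c i <;> simp [hb, hc] at this ⊢
    · exact h1 this.symm
    · exact h1 this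
  refine ⟨(n - 1) • (Finset.univ : Finset (Fin 3 → Bool)).val.map (signVec n), ?_, ?_⟩
  · simp; omega
  rintro ⟨t₁, t₂, hle, hc, hsum⟩
  set S := (n - 1) • (Finset.univ : Finset (Fin 3 → Bool)).val.map (signVec n) with hS
  have memS : ∀ x ∈ S, x 0 = 1 ∧ ∀ j, x j = 1 ∨ x j = -1 := by
    intro x hx
    have := Multiset.mem_of_mem_nsmul hx
    obtain ⟨b, -, rfl⟩ := Multiset.mem_map.1 this
    refine ⟨rfl, fun j => ?_⟩
    refine Fin.cases ?_ (fun i => ?_) j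
    · left; rfl
    · simp only [signVec, Fin.cons_succ]
      split_ifs <;> simp
  have hcount : ∀ x, S.count x ≤ n - 1 := by
    intro x
    rw [hS, Multiset.count_nsmul]
    have := Multiset.nodup_iff_count_le_one.1
      (Multiset.Nodup.map hinj (Finset.univ : Finset (Fin 3 → Bool)).nodup) x
    calc _ ≤ (n - 1) * 1 := Nat.mul_le_mul_left _ this
      _ = n - 1 := mul_one _
  have m1 : ∀ x ∈ t₁, x ∈ S := fun x hx =>
    Multiset.mem_of_le hle (Multiset.mem_add.2 (Or.inl hx))
  have m2 : ∀ x ∈ t₂, x ∈ S := fun x hx =>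
    Multiset.mem_of_le hle (Multiset.mem_add.2 (Or.inr hx))
  set u := t₁ + t₂.map (fun x => -x) with hu
  have hucard : Multiset.card u = n := by
    rw [hu, Multiset.card_add, Multiset.card_map, ← Multiset.card_add, hc]
  have husum : u.sum = 0 := by
    rw [hu, Multiset.sum_add, Multiset.sum_map_neg', hsum]; simp
  have uconst : ∀ x ∈ u, ∀ y ∈ u, x = y := by
    intro x hx y hy
    funext j
    refine pm_const hn h3 (u.map (fun z => z j)) ?_ (by simpa using hucard) ?_ _
      (Multiset.mem_map_of_mem _ hx) _ (Multiset.mem_map_of_mem _ hy)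
    · intro c hc
      obtain ⟨z, hz, rfl⟩ := Multiset.mem_map.1 hc
      rcases Multiset.mem_add.1 hz with hz | hz
      · exact (memS z (m1 z hz)).2 j
      · obtain ⟨w, hw, rfl⟩ := Multiset.mem_map.1 hz
        rcases (memS w (m2 w hw)).2 j with h | h <;> simp [h]
    · have := congrFun husum j
      rw [Pi.zero_apply] at this
      rw [← this]
      exact (map_multiset_sum (Pi.evalAddMonoidHom (fun _ => ZMod n) j) u).symm
  have tconst : ∀ x ∈ t₁ + t₂, ∀ y ∈ t₁ + t₂, x = y := by
    have u1 : ∀ x ∈ t₁, x ∈ u := fun x hx => Multiset.mem_add.2 (Or.inl hx)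
    have u2 : ∀ x ∈ t₂, -x ∈ u := fun x hx =>
      Multiset.mem_add.2 (Or.inr (Multiset.mem_map_of_mem _ hx))
    have cross : ∀ x ∈ t₁, ∀ y ∈ t₂, False := by
      intro x hx y hy
      have := congrFun (uconst x (u1 x hx) _ (u2 y hy)) 0
      rw [Pi.neg_apply, (memS x (m1 x hx)).1, (memS y (m2 y hy)).1] at this
      exact h1 this
    intro x hx y hy
    rcases Multiset.mem_add.1 hx with hx | hx <;> rcases Multiset.mem_add.1 hy with hy | hy
    · exact uconst x (u1 x hx) y (u1 y hy)
    · exact (cross x hx y hy).elim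
    · exact (cross y hy x hx).elim
    · exact neg_injective (uconst _ (u2 x hx) _ (u2 y hy))
  obtain ⟨x, hx⟩ := Multiset.card_pos_iff_exists_mem.1 (show 0 < Multiset.card (t₁ + t₂) by omega)
  have hcx : (t₁ + t₂).count x = Multiset.card (t₁ + t₂) :=
    Multiset.count_eq_card.2 (fun y hy => tconst x hx y hy)
  have := Multiset.count_le_of_le x hle
  have := hcount x
  omega

lemma exponent_pi_zmod (n : ℕ) : AddMonoid.exponent (Fin 4 → ZMod n) = n := by
  apply Nat.dvd_antisymm
  · apply AddMonoid.exponent_dvd_of_forall_nsmul_eq_zero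
    intro g
    funext j
    simp
  · have h := AddMonoid.exponent_nsmul_eq_zero (fun _ : Fin 4 => (1 : ZMod n))
    have := congrFun h 0
    rw [← ZMod.natCast_eq_zero_iff]
    simpa using this

/-- Theorem 3(iii): for all `a ≥ 1`,
`8·3^a - 7 ≤ s_A(C_{3^a}^4) ≤ 10·3^a - 9`; that is, every sequence over `C_{3^a}^4`
of length at least `10·3^a - 9` has a `{-1,1}`-zero-sum subsequence of length `3^a`,
and there is a sequence of length `8·3^a - 8` with no such subsequence. -/
theorem sA_three_pow_fourth (a : ℕ) (ha : 1 ≤ a) :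
    (8 * 3 ^ a - 7 ≤ sA (Fin 4 → ZMod (3 ^ a)) ∧
      sA (Fin 4 → ZMod (3 ^ a)) ≤ 10 * 3 ^ a - 9) ∧
    (∀ S : Multiset (Fin 4 → ZMod (3 ^ a)),
      10 * 3 ^ a - 9 ≤ Multiset.card S → HasWZSS S (3 ^ a)) ∧
    ∃ S : Multiset (Fin 4 → ZMod (3 ^ a)),
      Multiset.card S = 8 * 3 ^ a - 8 ∧ ¬ HasWZSS S (3 ^ a) := by
  have hodd : Odd (3 ^ a) := Odd.pow (by decide)
  have h3 : 3 ≤ 3 ^ a := by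
    calc 3 = 3 ^ 1 := rfl
      _ ≤ 3 ^ a := Nat.pow_le_pow_right (by norm_num) ha
  have hup := upper_multiset a ha
  obtain ⟨S, hSc, hS⟩ := lower_bound hodd h3
  refine ⟨⟨?_, ?_⟩, hup, S, hSc, hS⟩
  · refine le_csInf ⟨10 * 3 ^ a - 9, ?_⟩ ?_
    · intro T hT
      rw [exponent_pi_zmod]
      exact hup T hT
    · intro l hl
      by_contra hlt
      have := hl S (by omega)
      rw [exponent_pi_zmod] at this
      exact hS this
  · apply Nat.sInf_le
    intro T hT
    rw [exponent_pi_zmod]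
    exact hup T hT
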